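/- Let G be a finitely-generated discrete group with finite symmetric generating set X, and let ω be a weight on G. (i) If ω is a radial polynomial weight, i.e. ω(u) = (1 + |u|)^α for some α ≥ 0, or a radial exponential weight of degree strictly less than 1, i.e. ω(u) = c^{|u|^β} with c ≥ 1 and 0 < β < 1, then the augmentation ideal ℓ¹₀(G, ω) is finitely-generated only if G is finite. (ii) If ω is a radial exponential weight of degree equal to 1 with base c > 1, i.e. ω(u) = c^{|u|}, then ℓ¹₀(G, ω) is finitely-generated. -/

import Mathlib

noncomputable section

open scoped BigOperators

variable {G : Type*}

/-- Convolution of two functions on a (discrete) group: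
`(f ∗ g)(u) = ∑_{st = u} f(s) g(t)`. -/
def conv [Mul G] (f g : G → ℂ) : G → ℂ :=
  fun u => ∑' p : {p : G × G // p.1 * p.2 = u}, f (p : G × G).1 * g (p : G × G).2

/-- The weighted space `ℓ¹(G, ω)`, as a set of functions `G → ℂ`. -/
def l1w (ω : G → ℝ) : Set (G → ℂ) := {f | Summable fun u => ‖f u‖ * ω u}

/-- The augmentation ideal `ℓ¹₀(G, ω) = {f ∈ ℓ¹(G, ω) : ∑_u f(u) = 0}`. -/
def l1w0 (ω : G → ℝ) : Set (G → ℂ) := {f ∈ l1w ω | ∑' u, f u = 0}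

/-- `ω` is a weight on the group `G`. -/
def IsWeight [Monoid G] (ω : G → ℝ) : Prop :=
  (∀ u, 1 ≤ ω u) ∧ ω 1 = 1 ∧ ∀ u v, ω (u * v) ≤ ω u * ω v

/-- `I` is finitely generated as a left ideal of `ℓ¹(G, ω)`:
`I = A♯x₁ + ⋯ + A♯xₙ` for some `x₁, …, xₙ ∈ A = ℓ¹(G, ω)`, where `A♯` is the
(conditional) unitisation, so `A♯x = {a ∗ x + c x : a ∈ A, c ∈ ℂ}`;
no closure is taken. -/
def IsFinGenLeftIdealOf [Mul G] (ω : G → ℝ) (I : Set (G → ℂ)) : Prop :=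
  ∃ (n : ℕ) (x : Fin n → (G → ℂ)), (∀ i, x i ∈ l1w ω) ∧
    I = {f | ∃ (a : Fin n → (G → ℂ)) (c : Fin n → ℂ), (∀ i, a i ∈ l1w ω) ∧
          f = ∑ i, (conv (a i) (x i) + c i • x i)}

/-- The word length of `u` with respect to a (symmetric) generating set `X`. -/
def wordLength [Monoid G] (X : Set G) (u : G) : ℕ :=
  sInf {n | ∃ l : List G, l.length = n ∧ (∀ x ∈ l, x ∈ X) ∧ l.prod = u}

open Classical in
/-- shorthand for the unweighted space -/
abbrev L1s (G : Type*) := lp (fun _ : G => ℂ) 1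

lemma L1_summable (a : L1s G) : Summable fun s => ‖a s‖ := by
  have := (lp.memℓp a).summable (by simp)
  simpa using this

lemma L1_norm (a : L1s G) : ‖a‖ = ∑' s, ‖a s‖ := by
  have := lp.norm_eq_tsum_rpow (p := 1) (by simp) a
  simpa using this

open Classical in
lemma L1_hasSum {B : Type*} [NormedAddCommGroup B] [NormedSpace ℂ B] (L : L1s G →L[ℂ] B) (a : L1s G) :
    HasSum (fun s => a s • L (lp.single 1 s (1:ℂ))) (L a) := by
  have h := (lp.hasSum_single (p := 1) (by simp) a).mapL L
  refine h.congr_fun ?_ |> fun h => h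
  intro s
  rw [← map_smul, ← lp.single_smul]
  simp

open Classical in
lemma L1_bound {B : Type*} [NormedAddCommGroup B] [NormedSpace ℂ B] (L : L1s G →L[ℂ] B) (C : ℝ)
    (hC : ∀ s, ‖L (lp.single 1 s (1:ℂ))‖ ≤ C) (a : L1s G) : ‖L a‖ ≤ C * ‖a‖ := by
  have h := L1_hasSum L a
  rw [← h.tsum_eq, L1_norm, ← tsum_mul_left]
  have hs : Summable fun s => C * ‖a s‖ := (L1_summable a).mul_left C
  refine tsum_of_norm_bounded hs.hasSum ?_
  intro s
  rw [norm_smul, mul_comm]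
  exact mul_le_mul_of_nonneg_right (hC s) (norm_nonneg _)

open Classical in
lemma L1_exists {B : Type*} [NormedAddCommGroup B] [NormedSpace ℂ B] [CompleteSpace B]
    (b : G → B) (C : ℝ) (hb : ∀ s, ‖b s‖ ≤ C) :
    ∃ L : L1s G →L[ℂ] B, ∀ s, L (lp.single 1 s (1:ℂ)) = b s := by
  have hs : ∀ a : L1s G, Summable fun s => a s • b s := by
    intro a
    refine Summable.of_norm_bounded ((L1_summable a).mul_left C) ?_
    intro s
    rw [norm_smul, mul_comm]
    exact mul_le_mul_of_nonneg_right (hb s) (norm_nonneg _)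
  let L0 : L1s G →ₗ[ℂ] B :=
    { toFun := fun a => ∑' s, a s • b s
      map_add' := by
        intro a a'
        rw [← (hs a).tsum_add (hs a')]
        simp [add_smul]
      map_smul' := by
        intro c a
        simp only [RingHom.id_apply]
        rw [← (hs a).tsum_const_smul]
        simp [mul_smul] }
  refine ⟨L0.mkContinuous C ?_, ?_⟩
  · intro a
    change ‖∑' s, a s • b s‖ ≤ _
    rw [L1_norm, ← tsum_mul_left]
    refine tsum_of_norm_bounded ((L1_summable a).mul_left C).hasSum ?_
    intro s
    rw [norm_smul, mul_comm]
    exact mul_le_mul_of_nonneg_right (hb s) (norm_nonneg _)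
  · intro s
    change ∑' t, (lp.single 1 s (1:ℂ) : L1s G) t • b t = b s
    rw [tsum_eq_single s]
    · simp
    · intro t ht
      rw [lp.single_apply_ne _ _ _ ht, zero_smul]

/-- weighted coordinates -/
def toW (ω : G → ℝ) (hp : ∀ u, 1 ≤ ω u) (f : G → ℂ) (hf : f ∈ l1w ω) : L1s G :=
  ⟨fun u => f u * ω u, by
    refine memℓp_gen ?_
    refine Summable.congr (f := fun u => ‖f u‖ * ω u) hf ?_
    intro u
    have : 0 ≤ ω u := by linarith [hp u]
    simp [abs_of_nonneg this]⟩

lemma toW_apply (ω : G → ℝ) (hp : ∀ u, 1 ≤ ω u) (f : G → ℂ) (hf : f ∈ l1w ω) (u : G) :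
    toW ω hp f hf u = f u * ω u := rfl

lemma norm_toW (ω : G → ℝ) (hp : ∀ u, 1 ≤ ω u) (f : G → ℂ) (hf : f ∈ l1w ω) :
    ‖toW ω hp f hf‖ = ∑' u, ‖f u‖ * ω u := by
  rw [L1_norm]
  congr 1; ext u
  have : 0 ≤ ω u := by linarith [hp u]
  simp [toW_apply, abs_of_nonneg this]

lemma ofW_mem (ω : G → ℝ) (hp : ∀ u, 1 ≤ ω u) (g : L1s G) : (fun u => g u / (ω u : ℂ)) ∈ l1w ω := by
  refine Summable.congr (f := fun u => ‖g u‖) (L1_summable g) ?_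
  intro u
  have : 0 < ω u := by linarith [hp u]
  simp only [norm_div, Complex.norm_real, Real.norm_eq_abs, abs_of_pos this]
  field_simp

lemma mem_of_toW (ω : G → ℝ) (hp : ∀ u, 1 ≤ ω u) (g : L1s G) (f : G → ℂ) (h : ∀ u, g u = f u * ω u) :
    f ∈ l1w ω := by
  convert ofW_mem ω hp g using 2 with u
  have : (ω u : ℂ) ≠ 0 := by
    have : 0 < ω u := by linarith [hp u]
    exact_mod_cast this.ne'
  rw [h]; field_simp

lemma toW_ofW (ω : G → ℝ) (hp : ∀ u, 1 ≤ ω u) (g : L1s G) : toW ω hp _ (ofW_mem ω hp g) = g := by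
  ext u
  have : (ω u : ℂ) ≠ 0 := by
    have : 0 < ω u := by linarith [hp u]
    exact_mod_cast this.ne'
  rw [toW_apply]; field_simp

lemma l1w_summable (ω : G → ℝ) (hp : ∀ u, 1 ≤ ω u) (f : G → ℂ) (hf : f ∈ l1w ω) :
    Summable fun u => ‖f u‖ :=
  Summable.of_nonneg_of_le (fun u => norm_nonneg _)
    (fun u => le_mul_of_one_le_right (norm_nonneg _) (hp u)) hf

lemma conv_eq [Group G] (a x : G → ℂ) (u : G) : conv a x u = ∑' s, a s * x (s⁻¹ * u) := by
  let e : G ≃ {p : G × G // p.1 * p.2 = u} :=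
    { toFun := fun s => ⟨(s, s⁻¹ * u), by simp⟩
      invFun := fun p => p.1.1
      left_inv := fun s => rfl
      right_inv := by
        rintro ⟨⟨s, t⟩, h⟩
        simp only at h
        subst h
        simp }
  unfold conv
  rw [← e.tsum_eq]
  rfl

/-- translates -/
lemma trans_mem [Group G] (ω : G → ℝ) (hω : IsWeight ω) (x : G → ℂ) (hx : x ∈ l1w ω) (s : G) :
    (fun u => x (s⁻¹ * u)) ∈ l1w ω ∧
      ∑' u, ‖x (s⁻¹ * u)‖ * ω u ≤ ω s * ∑' u, ‖x u‖ * ω u := by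
  have key : Summable fun t => ‖x t‖ * ω (s * t) := by
    refine Summable.of_nonneg_of_le (fun t => ?_) (fun t => ?_) (Summable.mul_left (ω s) hx)
    · have := hω.1 (s * t); positivity
    · have := mul_le_mul_of_nonneg_left (hω.2.2 s t) (norm_nonneg (x t))
      linarith
  have e : (fun t => ‖x t‖ * ω (s * t)) = (fun u => ‖x (s⁻¹ * u)‖ * ω u) ∘ (Equiv.mulLeft s) := by
    ext t; simp
  constructor
  · rw [e] at key
    exact ((Equiv.mulLeft s).summable_iff).1 key
  · rw [← (Equiv.mulLeft s).tsum_eq, ← tsum_mul_left]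
    refine Summable.tsum_le_tsum (fun t => ?_) ?_ (Summable.mul_left (ω s) hx)
    · have := mul_le_mul_of_nonneg_left (hω.2.2 s t) (norm_nonneg (x t))
      simp; linarith
    · simpa using key

open Classical in
lemma exists_T [Group G] (ω : G → ℝ) (hω : IsWeight ω) (x : G → ℂ) (hx : x ∈ l1w ω) :
    ∃ T : L1s G →L[ℂ] L1s G,
      (∀ s u, T (lp.single 1 s (1:ℂ)) u = x (s⁻¹ * u) * ω u / ω s) ∧
      (∀ a (ha : a ∈ l1w ω) u, T (toW ω hω.1 a ha) u = conv a x u * ω u) := by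
  have h0 : ∀ u, (ω u : ℂ) ≠ 0 := by
    intro u
    have : 0 < ω u := by linarith [hω.1 u]
    exact_mod_cast this.ne'
  obtain ⟨T, hT⟩ := L1_exists
    (fun s => ((ω s : ℂ)⁻¹) • toW ω hω.1 _ (trans_mem ω hω x hx s).1) (∑' u, ‖x u‖ * ω u) (by
      intro s
      have hs : 0 < ω s := by linarith [hω.1 s]
      rw [norm_smul, norm_toW]
      simp only [norm_inv, Complex.norm_real, Real.norm_eq_abs, abs_of_pos hs]
      rw [inv_mul_le_iff₀ hs]
      exact (trans_mem ω hω x hx s).2)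
  have h1 : ∀ s u, T (lp.single 1 s (1:ℂ)) u = x (s⁻¹ * u) * ω u / ω s := by
    intro s u
    rw [hT, lp.coeFn_smul, Pi.smul_apply, toW_apply, smul_eq_mul]
    field_simp [h0 s]
  refine ⟨T, h1, ?_⟩
  intro a ha u
  have h := L1_hasSum ((lp.evalCLM ℂ (fun _ : G => ℂ) 1 u).comp T) (toW ω hω.1 a ha)
  have h2 : T (toW ω hω.1 a ha) u = ((lp.evalCLM ℂ (fun _ : G => ℂ) 1 u).comp T) (toW ω hω.1 a ha) := rfl
  rw [h2, ← h.tsum_eq, conv_eq, ← tsum_mul_right]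
  congr 1; ext s
  have h3 : ((lp.evalCLM ℂ (fun _ : G => ℂ) 1 u).comp T) (lp.single 1 s (1:ℂ)) = T (lp.single 1 s (1:ℂ)) u := rfl
  rw [h3, h1, toW_apply, smul_eq_mul]
  field_simp [h0 s]

open Classical in
/-- pairing with a function dominated by the weight -/
lemma exists_P (ω : G → ℝ) (hp : ∀ u, 1 ≤ ω u) (φ : G → ℂ) (M : ℝ) (hM : ∀ u, ‖φ u‖ ≤ M * ω u) :
    ∃ P : L1s G →L[ℂ] ℂ, (∀ s, P (lp.single 1 s (1:ℂ)) = φ s / ω s) ∧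
      ∀ g, P g = ∑' u, g u * (φ u / ω u) := by
  obtain ⟨P, hP⟩ := L1_exists (fun s => φ s / (ω s : ℂ)) M (by
    intro s
    have hs : 0 < ω s := by linarith [hp s]
    simp only [norm_div, Complex.norm_real, Real.norm_eq_abs, abs_of_pos hs]
    rw [div_le_iff₀ hs]; exact hM s)
  refine ⟨P, hP, fun g => ?_⟩
  rw [← (L1_hasSum P g).tsum_eq]
  simp [hP]

open Classical in
lemma P_T [Group G] (ω : G → ℝ) (hω : IsWeight ω) (x φ : G → ℂ) (P : L1s G →L[ℂ] ℂ) (T : L1s G →L[ℂ] L1s G)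
    (hP : ∀ g, P g = ∑' u, g u * (φ u / ω u))
    (hT : ∀ s u, T (lp.single 1 s (1:ℂ)) u = x (s⁻¹ * u) * ω u / ω s) (s : G) :
    P (T (lp.single 1 s (1:ℂ))) = (∑' t, x t * φ (s * t)) / ω s := by
  have h0 : ∀ u, (ω u : ℂ) ≠ 0 := by
    intro u
    have : 0 < ω u := by linarith [hω.1 u]
    exact_mod_cast this.ne'
  rw [hP, ← (Equiv.mulLeft s).tsum_eq, ← tsum_div_const]
  congr 1; ext t
  simp only [Equiv.coe_mulLeft, hT, inv_mul_cancel_left]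
  field_simp [h0 s, h0 (s * t)]

lemma exists_Ct [Group G] (X : Finset G) (hXsym : ∀ x ∈ X, x⁻¹ ∈ X)
    (hXgen : Subgroup.closure (X : Set G) = ⊤) (ω : G → ℝ) (hω : IsWeight ω) (t : G) :
    ∃ C : ℝ, 0 ≤ C ∧ ∀ φ : G → ℂ, (∀ v, ∀ x ∈ X, ‖φ (v * x) - φ v‖ ≤ ω v) →
      ∀ s, ‖φ (s * t) - φ s‖ ≤ C * ω s := by
  have step : ∀ t : G, ∀ x ∈ X, (∃ C : ℝ, 0 ≤ C ∧ ∀ φ : G → ℂ, (∀ v, ∀ x ∈ X, ‖φ (v * x) - φ v‖ ≤ ω v) →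
      ∀ s, ‖φ (s * t) - φ s‖ ≤ C * ω s) → (∃ C : ℝ, 0 ≤ C ∧ ∀ φ : G → ℂ, (∀ v, ∀ x ∈ X, ‖φ (v * x) - φ v‖ ≤ ω v) →
      ∀ s, ‖φ (s * (t * x)) - φ s‖ ≤ C * ω s) := by
    rintro t x hx ⟨C, hC0, hC⟩
    refine ⟨C + ω t, by linarith [hω.1 t], fun φ hφ s => ?_⟩
    have h1 := hφ (s * t) x hx
    have h2 := hC φ hφ s
    have h3 := hω.2.2 s t
    have h4 : ‖φ (s * (t * x)) - φ s‖ ≤ ‖φ (s * t * x) - φ (s * t)‖ + ‖φ (s * t) - φ s‖ := by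
      rw [← mul_assoc]
      exact norm_sub_le_norm_sub_add_norm_sub _ _ _
    nlinarith
  have ht : t ∈ Subgroup.closure (X : Set G) := by rw [hXgen]; trivial
  induction ht using Subgroup.closure_induction_right with
  | one => exact ⟨0, le_rfl, fun φ hφ s => by simp⟩
  | mul_right t ht x hx ih => exact step t x hx ih
  | mul_inv_cancel t ht x hx ih => exact step t _ (hXsym x hx) ih

open Classical in
lemma exists_D [Group G] (X : Finset G) (hXsym : ∀ x ∈ X, x⁻¹ ∈ X)
    (hXgen : Subgroup.closure (X : Set G) = ⊤) (ω : G → ℝ) (hω : IsWeight ω)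
    (x : G → ℂ) (hx : x ∈ l1w0 ω) (ε : ℝ) (hε : 0 < ε) :
    ∃ C : ℝ, 0 ≤ C ∧ ∀ φ : G → ℂ, (∀ v, ∀ x ∈ X, ‖φ (v * x) - φ v‖ ≤ ω v) →
      ∀ M, (∀ u, ‖φ u‖ ≤ M * ω u) → ∀ s, ‖∑' t, x t * φ (s * t)‖ ≤ (C + ε * M) * ω s := by
  choose Ct hCt0 hCt using exists_Ct X hXsym hXgen ω hω
  set f : G → ℝ := fun t => ‖x t‖ * ω t with hf
  have hfs : Summable f := hx.1
  have hf0 : ∀ t, 0 ≤ f t := fun t => by have := hω.1 t; positivity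
  obtain ⟨F, hF⟩ : ∃ F : Finset G, ∑' t, f t - ∑ t ∈ F, f t < ε / 2 := by
    have h := hfs.hasSum
    have h2 : ∀ᶠ F : Finset G in Filter.atTop, ∑' t, f t - ε / 2 < ∑ t ∈ F, f t :=
      h.eventually (lt_mem_nhds (by linarith))
    obtain ⟨F, hF⟩ := h2.exists
    exact ⟨F, by linarith⟩
  refine ⟨∑ t ∈ F, ‖x t‖ * Ct t, Finset.sum_nonneg fun t _ => mul_nonneg (norm_nonneg _) (hCt0 t), ?_⟩
  intro φ hφ M hM s
  have hs1 := hω.1 s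
  have hM0 : 0 ≤ M := by
    have h1 := (norm_nonneg _).trans (hM 1)
    rw [hω.2.1] at h1; linarith
  have hxs : Summable x := (l1w_summable ω hω.1 x hx.1).of_norm
  have hS1 : Summable fun t => x t * φ (s * t) := by
    refine Summable.of_norm_bounded (hfs.mul_left (M * ω s)) fun t => ?_
    rw [norm_mul]
    have h1 := hM (s * t)
    have h2 := mul_le_mul_of_nonneg_left (hω.2.2 s t) hM0
    have h3 := mul_le_mul_of_nonneg_left (h1.trans h2) (norm_nonneg (x t))
    simp only [hf]; linarith
  have hS2 : Summable fun t => x t * φ s := hxs.mul_right _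
  have e : ∑' t, x t * φ (s * t) = ∑' t, x t * (φ (s * t) - φ s) := by
    have : ∑' t, x t * φ s = 0 := by rw [tsum_mul_right, hx.2, zero_mul]
    rw [← sub_zero (∑' t, x t * φ (s * t)), ← this, ← hS1.tsum_sub hS2]
    congr 1; ext t; ring
  rw [e]
  have hA : HasSum (fun t => if t ∈ F then ‖x t‖ * Ct t else 0) (∑ t ∈ F, ‖x t‖ * Ct t) := by
    have := hasSum_sum_of_ne_finset_zero (L := SummationFilter.unconditional G) (f := fun t => if t ∈ F then ‖x t‖ * Ct t else 0) (s := F)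
      (fun b hb => by simp [hb])
    convert this using 1
    exact Finset.sum_congr rfl fun t ht => by simp [ht]
  have hB : HasSum (fun t => if t ∈ F then f t else 0) (∑ t ∈ F, f t) := by
    have := hasSum_sum_of_ne_finset_zero (L := SummationFilter.unconditional G) (f := fun t => if t ∈ F then f t else 0) (s := F)
      (fun b hb => by simp [hb])
    convert this using 1
    exact Finset.sum_congr rfl fun t ht => by simp [ht]
  have hT := (hA.mul_left (ω s)).add ((hfs.hasSum.sub hB).mul_left (2 * M * ω s))
  refine (tsum_of_norm_bounded hT ?_).trans ?_
  · intro t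
    rw [norm_mul]
    by_cases ht : t ∈ F
    · simp only [ht, if_true, sub_self, mul_zero, add_zero]
      have := mul_le_mul_of_nonneg_left (hCt t φ hφ s) (norm_nonneg (x t))
      linarith
    · simp only [ht, if_false, mul_zero, sub_zero, zero_add, hf]
      have h1 := hM (s * t)
      have h2 := mul_le_mul_of_nonneg_left (hω.2.2 s t) hM0
      have h3 := hM s
      have h4 : M * ω s ≤ M * (ω s * ω t) := by
        apply mul_le_mul_of_nonneg_left _ hM0
        exact le_mul_of_one_le_right (by linarith) (hω.1 t)
      have h5 : ‖φ (s * t) - φ s‖ ≤ 2 * M * (ω s * ω t) := (norm_sub_le _ _).trans (by linarith)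
      have := mul_le_mul_of_nonneg_left h5 (norm_nonneg (x t))
      linarith
  · have : 2 * M * ω s * (∑' t, f t - ∑ t ∈ F, f t) ≤ 2 * M * ω s * (ε / 2) :=
      mul_le_mul_of_nonneg_left hF.le (by positivity)
    linarith

open Classical in
lemma lemA [Group G] (X : Finset G) (hXsym : ∀ x ∈ X, x⁻¹ ∈ X)
    (hXgen : Subgroup.closure (X : Set G) = ⊤) (ω : G → ℝ) (hω : IsWeight ω)
    (hfg : IsFinGenLeftIdealOf ω (l1w0 ω)) :
    ∃ K : ℝ, ∀ φ : G → ℂ, (∃ M, ∀ u, ‖φ u‖ ≤ M) → φ 1 = 0 →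
      (∀ v, ∀ x ∈ X, ‖φ (v * x) - φ v‖ ≤ ω v) → ∀ u, ‖φ u‖ ≤ K * ω u := by
  have h0 : ∀ u, (ω u : ℂ) ≠ 0 := by
    intro u
    have : 0 < ω u := by linarith [hω.1 u]
    exact_mod_cast this.ne'
  obtain ⟨n, x, hx, hI⟩ := hfg
  have hx0 : ∀ i, x i ∈ l1w0 ω := by
    intro i
    rw [hI]
    refine ⟨fun _ => 0, Pi.single i 1, fun j => ?_, ?_⟩
    · simp [l1w, summable_zero]
    · have : ∀ y : G → ℂ, conv (0 : G → ℂ) y = 0 := by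
        intro y; ext u; simp [conv_eq]
      simp only [this, zero_add]
      rw [Finset.sum_eq_single i]
      · simp
      · intro j _ hj; simp [hj]
      · simp
  choose T hT1 hT2 using fun i => exists_T ω hω (x i) (hx i)
  let e1 : L1s G := lp.single 1 (1 : G) (1 : ℂ)
  let Tb : ((Fin n → L1s G) × (Fin n → ℂ) × ℂ) →L[ℂ] L1s G :=
    (∑ i, (T i).comp ((ContinuousLinearMap.proj i).comp (ContinuousLinearMap.fst ℂ _ _)))
    + (∑ i, (ContinuousLinearMap.toSpanSingleton ℂ (T i e1)).comp ((ContinuousLinearMap.proj i).comp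
        ((ContinuousLinearMap.fst ℂ _ _).comp (ContinuousLinearMap.snd ℂ _ _))))
    + (ContinuousLinearMap.toSpanSingleton ℂ e1).comp
        ((ContinuousLinearMap.snd ℂ _ _).comp (ContinuousLinearMap.snd ℂ _ _))
  have hTb : ∀ p, Tb p = ∑ i, T i (p.1 i) + ∑ i, p.2.1 i • T i e1 + p.2.2 • e1 := by
    intro p
    simp [Tb]
  have hsurj : Function.Surjective Tb := by
    intro g
    set f : G → ℂ := fun u => g u / (ω u : ℂ) with hf
    have hfm : f ∈ l1w ω := ofW_mem ω hω.1 g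
    set lam : ℂ := ∑' u, f u with hlam
    have hdm : (fun u => lam * (Pi.single (1:G) (1:ℂ) : G → ℂ) u) ∈ l1w ω := by
      apply summable_of_ne_finset_zero (s := {1})
      intro b hb
      have : b ≠ 1 := by simpa using hb
      simp [this]
    have hd : HasSum (fun u => lam * (Pi.single (1:G) (1:ℂ) : G → ℂ) u) lam := by
      have := hasSum_single (f := fun u => lam * (Pi.single (1:G) (1:ℂ) : G → ℂ) u) 1
        (fun b hb => by simp [hb])
      simpa using this
    have hmem : (fun u => f u - lam * (Pi.single (1:G) (1:ℂ) : G → ℂ) u) ∈ l1w0 ω := by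
      constructor
      · refine Summable.of_nonneg_of_le (fun u => ?_) (fun u => ?_) (Summable.add hfm hdm)
        · have := hω.1 u; positivity
        · rw [← add_mul]
          exact mul_le_mul_of_nonneg_right (norm_sub_le _ _) (by linarith [hω.1 u])
      · rw [(l1w_summable ω hω.1 f hfm).of_norm.tsum_sub hd.summable, hd.tsum_eq, sub_self]
    rw [hI] at hmem
    obtain ⟨a, c, ha, hac⟩ := hmem
    refine ⟨(fun i => toW ω hω.1 (a i) (ha i), c, lam), ?_⟩
    rw [hTb]
    ext u
    have hu := congrFun hac u
    simp only [Finset.sum_apply, Pi.add_apply, Pi.smul_apply, smul_eq_mul, Finset.sum_add_distrib] at hu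
    simp only [lp.coeFn_add, Pi.add_apply, lp.coeFn_sum, Finset.sum_apply, lp.coeFn_smul,
      Pi.smul_apply, smul_eq_mul, hT2]
    have e2 : ∀ i, T i e1 u = x i u * ω u := by
      intro i; rw [hT1]; simp [hω.2.1]
    have e3 : e1 u = (Pi.single (1:G) (1:ℂ) : G → ℂ) u * ω u := by
      change (Pi.single (1:G) (1:ℂ) : G → ℂ) u = _
      by_cases h : u = 1
      · subst h; simp [hω.2.1]
      · simp [h]
    simp only [e2, e3]
    have hg : g u = f u * ω u := by simp only [hf]; field_simp [h0 u]
    rw [hg, sub_eq_iff_eq_add.1 hu, add_mul, add_mul, Finset.sum_mul, Finset.sum_mul]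
    simp only [mul_assoc]
  obtain ⟨K, hK0, hK⟩ := Tb.exists_preimage_norm_le hsurj
  set ε : ℝ := 1 / (4 * n * K + 1) with hεd
  have hε : 0 < ε := by positivity
  have hεK : 2 * n * K * ε ≤ 1 / 2 := by
    rw [hεd, mul_one_div, div_le_iff₀ (by positivity)]; nlinarith
  choose C hC0 hC using fun i => exists_D X hXsym hXgen ω hω (x i) (hx0 i) ε hε
  set CC := ∑ i, C i with hCC
  have hCi : ∀ i, C i ≤ CC := fun i => Finset.single_le_sum (fun j _ => hC0 j) (Finset.mem_univ i)
  refine ⟨2 * (2 * n * K * CC), ?_⟩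
  intro φ ⟨M', hM'⟩ hφ1 hφ
  have key : ∀ M, (∀ u, ‖φ u‖ ≤ M * ω u) → ∀ u, ‖φ u‖ ≤ (2 * n * K * CC + M / 2) * ω u := by
    intro M hM u
    have hM0 : 0 ≤ M := by
      have h1 := (norm_nonneg _).trans (hM 1)
      rw [hω.2.1] at h1; linarith
    have hu : 0 < ω u := by linarith [hω.1 u]
    obtain ⟨P, hP1, hP2⟩ := exists_P ω hω.1 φ M hM
    have hD : ∀ i s, ‖P (T i (lp.single 1 s (1:ℂ)))‖ ≤ CC + ε * M := by
      intro i s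
      have hs : 0 < ω s := by linarith [hω.1 s]
      rw [P_T ω hω (x i) φ P (T i) hP2 (hT1 i) s, norm_div, Complex.norm_real, Real.norm_eq_abs,
        abs_of_pos hs, div_le_iff₀ hs]
      refine (hC i φ hφ M hM s).trans ?_
      exact mul_le_mul_of_nonneg_right (by linarith [hCi i]) hs.le
    have hD' : ∀ i a, ‖P (T i a)‖ ≤ (CC + ε * M) * ‖a‖ := fun i a =>
      L1_bound (P.comp (T i)) _ (hD i) a
    have hCC0 : 0 ≤ CC + ε * M := by
      have : 0 ≤ CC := Finset.sum_nonneg fun i _ => hC0 i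
      positivity
    obtain ⟨p, hp, hpn⟩ := hK (lp.single 1 u (1:ℂ))
    rw [lp.norm_single (by simp), norm_one, mul_one] at hpn
    have h1 : ∀ i, ‖p.1 i‖ ≤ K := fun i => (norm_le_pi_norm _ i).trans ((norm_fst_le p).trans hpn)
    have h2 : ∀ i, ‖p.2.1 i‖ ≤ K := fun i =>
      (norm_le_pi_norm _ i).trans ((norm_fst_le p.2).trans ((norm_snd_le p).trans hpn))
    have h3 : ‖P (lp.single 1 u (1:ℂ))‖ ≤ n * ((CC + ε * M) * K) + n * ((CC + ε * M) * K) := by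
      rw [← hp, hTb, map_add, map_add, map_sum, map_sum, map_smul, hP1, hφ1]
      simp only [zero_div, smul_zero, add_zero]
      refine (norm_add_le _ _).trans (add_le_add ?_ ?_)
      · refine (norm_sum_le_of_le (f := fun i => P (T i (p.1 i))) (n := fun _ => (CC + ε * M) * K)
          Finset.univ ?_).trans ?_
        · intro i _
          exact (hD' i _).trans (mul_le_mul_of_nonneg_left (h1 i) hCC0)
        · simp
      · refine (norm_sum_le_of_le (n := fun _ => (CC + ε * M) * K)
          Finset.univ ?_).trans ?_
        · intro i _
          rw [map_smul, norm_smul, mul_comm]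
          exact mul_le_mul (hD i _) (h2 i) (norm_nonneg _) hCC0
        · simp
    rw [hP1, norm_div, Complex.norm_real, Real.norm_eq_abs, abs_of_pos hu, div_le_iff₀ hu] at h3
    refine h3.trans (mul_le_mul_of_nonneg_right ?_ hu.le)
    have := mul_le_mul_of_nonneg_right hεK hM0
    linarith
  have hbdd : BddAbove (Set.range fun u => ‖φ u‖ / ω u) := by
    refine ⟨M', ?_⟩
    rintro _ ⟨u, rfl⟩
    exact (div_le_self (norm_nonneg _) (hω.1 u)).trans (hM' u)
  have hS : ∀ u, ‖φ u‖ ≤ (⨆ u, ‖φ u‖ / ω u) * ω u := by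
    intro u
    have hu : 0 < ω u := by linarith [hω.1 u]
    rw [← div_le_iff₀ hu]
    exact le_ciSup hbdd u
  have hk := key _ hS
  have : (⨆ u, ‖φ u‖ / ω u) ≤ 2 * n * K * CC + (⨆ u, ‖φ u‖ / ω u) / 2 := by
    have : Nonempty G := ⟨1⟩
    refine ciSup_le fun u => ?_
    have hu : 0 < ω u := by linarith [hω.1 u]
    rw [div_le_iff₀ hu]
    exact hk u
  intro u
  refine (hS u).trans (mul_le_mul_of_nonneg_right (by linarith) (by linarith [hω.1 u]))

lemma exists_word [Group G] (X : Finset G) (hXsym : ∀ x ∈ X, x⁻¹ ∈ X)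
    (hXgen : Subgroup.closure (X : Set G) = ⊤) (u : G) :
    ∃ l : List G, (∀ x ∈ l, x ∈ (X : Set G)) ∧ l.prod = u := by
  have hu : u ∈ Subgroup.closure (X : Set G) := by rw [hXgen]; trivial
  have step : ∀ t : G, ∀ x ∈ X, (∃ l : List G, (∀ x ∈ l, x ∈ (X : Set G)) ∧ l.prod = t) →
      ∃ l : List G, (∀ x ∈ l, x ∈ (X : Set G)) ∧ l.prod = t * x := by
    rintro t x hx ⟨l, hl, rfl⟩
    refine ⟨l ++ [x], ?_, by simp⟩
    intro y hy
    rcases List.mem_append.1 hy with h | h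
    · exact hl y h
    · rw [List.mem_singleton.1 h]; exact hx
  induction hu using Subgroup.closure_induction_right with
  | one => exact ⟨[], by simp, by simp⟩
  | mul_right t ht x hx ih => exact step t x hx ih
  | mul_inv_cancel t ht x hx ih => exact step t _ (hXsym x hx) ih

lemma wl_spec [Group G] (X : Finset G) (hXsym : ∀ x ∈ X, x⁻¹ ∈ X)
    (hXgen : Subgroup.closure (X : Set G) = ⊤) (u : G) :
    ∃ l : List G, l.length = wordLength (X : Set G) u ∧ (∀ x ∈ l, x ∈ (X : Set G)) ∧ l.prod = u := by
  obtain ⟨l, hl, hp⟩ := exists_word X hXsym hXgen u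
  exact Nat.sInf_mem (s := {n | ∃ l : List G, l.length = n ∧ (∀ x ∈ l, x ∈ (X : Set G)) ∧ l.prod = u})
    ⟨l.length, l, rfl, hl, hp⟩

lemma wl_le [Group G] (X : Finset G) (l : List G) (hl : ∀ x ∈ l, x ∈ (X : Set G)) :
    wordLength (X : Set G) l.prod ≤ l.length :=
  Nat.sInf_le ⟨l, rfl, hl, rfl⟩

lemma wl_one [Group G] (X : Finset G) : wordLength (X : Set G) 1 = 0 := by
  have := wl_le X [] (by simp)
  simpa using this

lemma wl_mul [Group G] (X : Finset G) (hXsym : ∀ x ∈ X, x⁻¹ ∈ X)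
    (hXgen : Subgroup.closure (X : Set G) = ⊤) (u x : G) (hx : x ∈ X) :
    wordLength (X : Set G) (u * x) ≤ wordLength (X : Set G) u + 1 := by
  obtain ⟨l, h1, h2, rfl⟩ := wl_spec X hXsym hXgen u
  have := wl_le X (l ++ [x]) (by
    intro y hy
    rcases List.mem_append.1 hy with h | h
    · exact h2 y h
    · rw [List.mem_singleton.1 h]; exact hx)
  simpa [h1] using this

lemma wl_mul' [Group G] (X : Finset G) (hXsym : ∀ x ∈ X, x⁻¹ ∈ X)
    (hXgen : Subgroup.closure (X : Set G) = ⊤) (u x : G) (hx : x ∈ X) :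
    wordLength (X : Set G) u ≤ wordLength (X : Set G) (u * x) + 1 := by
  have := wl_mul X hXsym hXgen (u * x) _ (hXsym x hx)
  simpa using this

lemma wl_pred [Group G] (X : Finset G) (hXsym : ∀ x ∈ X, x⁻¹ ∈ X)
    (hXgen : Subgroup.closure (X : Set G) = ⊤) (u : G) (n : ℕ) (hn : wordLength (X : Set G) u = n + 1) :
    ∃ v, ∃ x ∈ X, u = v * x ∧ wordLength (X : Set G) v = n := by
  obtain ⟨l, h1, h2, rfl⟩ := wl_spec X hXsym hXgen u
  rcases List.eq_nil_or_concat l with h | ⟨l', x, h⟩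
  · subst h; rw [hn] at h1; simp at h1
  · subst h
    have hx : x ∈ X := h2 x (by simp)
    refine ⟨l'.prod, x, hx, by simp, ?_⟩
    have h3 := wl_le X l' (fun y hy => h2 y (by simp [hy]))
    have h4 := wl_mul X hXsym hXgen l'.prod x hx
    simp at h1 hn
    omega

lemma wl_surj [Group G] (X : Finset G) (hXsym : ∀ x ∈ X, x⁻¹ ∈ X)
    (hXgen : Subgroup.closure (X : Set G) = ⊤) (hinf : ¬ Finite G) (n : ℕ) :
    ∃ u, wordLength (X : Set G) u = n := by
  by_contra hcon
  push Not at hcon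
  apply hinf
  have hlt : ∀ k : ℕ, ∀ u, wordLength (X : Set G) u = k → k < n := by
    intro k
    induction k with
    | zero => intro u hu; have := hcon u; omega
    | succ k ih =>
      intro u hu
      obtain ⟨v, x, hx, rfl, hv⟩ := wl_pred X hXsym hXgen u k hu
      have h1 := ih v hv
      have h2 := hcon (v * x)
      omega
  have hfin : ((fun l : List X => (l.map Subtype.val).prod) '' {l : List X | l.length < n}).Finite :=
    (List.finite_length_lt X n).image _
  have huniv : (Set.univ : Set G) ⊆ (fun l : List X => (l.map Subtype.val).prod) '' {l : List X | l.length < n} := by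
    intro u _
    obtain ⟨l, h1, h2, rfl⟩ := wl_spec X hXsym hXgen u
    have h3 := hlt _ _ h1.symm
    lift l to List X using h2
    exact ⟨l, by simpa using h3, rfl⟩
  exact Set.finite_univ_iff.1 (hfin.subset huniv)

lemma growth [Group G] (X : Finset G) (hXsym : ∀ x ∈ X, x⁻¹ ∈ X)
    (hXgen : Subgroup.closure (X : Set G) = ⊤) (ω : G → ℝ) (hω : IsWeight ω)
    (hfg : IsFinGenLeftIdealOf ω (l1w0 ω)) (hinf : ¬ Finite G)
    (w : ℕ → ℝ) (hw : Monotone w) (hw1 : ∀ n, 1 ≤ w n) (hωw : ∀ u, ω u = w (wordLength (X : Set G) u)) :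
    ∃ a > 0, ∃ r > 1, ∀ n : ℕ, a * r ^ n ≤ w (n + 1) := by
  obtain ⟨K, hK⟩ := lemA X hXsym hXgen ω hω hfg
  have hw0 : ∀ n, 0 ≤ w n := fun n => by linarith [hw1 n]
  have hS : ∀ n, ∑ k ∈ Finset.range n, w k ≤ K * w n := by
    intro N
    obtain ⟨u, hu⟩ := wl_surj X hXsym hXgen hinf N
    set Φ : ℕ → ℝ := fun m => ∑ k ∈ Finset.range (min m N), w k with hΦ
    have hΦ0 : ∀ m, 0 ≤ Φ m := fun m => Finset.sum_nonneg fun k _ => hw0 k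
    have hΦm : Monotone Φ := by
      intro a b hab
      apply Finset.sum_le_sum_of_subset_of_nonneg
      · intro k; simp only [Finset.mem_range]; omega
      · intro k _ _; exact hw0 k
    have hΦs : ∀ m, Φ (m + 1) ≤ Φ m + w m := by
      intro m
      simp only [hΦ]
      rcases le_or_gt N m with h | h
      · rw [min_eq_right h, min_eq_right (by omega)]; linarith [hw0 m]
      · rw [min_eq_left h.le, min_eq_left (by omega), Finset.sum_range_succ]
    have h := hK (fun v => ((Φ (wordLength (X : Set G) v) : ℝ) : ℂ)) ?_ ?_ ?_ u
    · rw [hωw, hu] at h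
      simp only [Complex.norm_real, Real.norm_eq_abs, abs_of_nonneg (hΦ0 _)] at h
      simpa [hΦ] using h
    · refine ⟨∑ k ∈ Finset.range N, w k, fun v => ?_⟩
      simp only [Complex.norm_real, Real.norm_eq_abs, abs_of_nonneg (hΦ0 _)]
      apply Finset.sum_le_sum_of_subset_of_nonneg
      · intro k; simp only [Finset.mem_range]; omega
      · intro k _ _; exact hw0 k
    · simp [wl_one, hΦ]
    · intro v x hx
      rw [← Complex.ofReal_sub, Complex.norm_real, Real.norm_eq_abs, hωw]
      have h1 := wl_mul X hXsym hXgen v x hx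
      have h2 := wl_mul' X hXsym hXgen v x hx
      generalize wordLength (X : Set G) (v * x) = p at *
      generalize wordLength (X : Set G) v = q at *
      rw [abs_le]
      constructor
      · have h3 := hΦm h2
        have h4 := hΦs p
        rcases Nat.lt_or_ge q p with h | h
        · have := hΦm h.le; linarith [hw0 q]
        · have := hw h; linarith
      · have h3 := hΦm h1
        have h4 := hΦs q
        linarith
  have hK0 : 0 < K := by
    have h := hS 1
    simp only [Finset.range_one, Finset.sum_singleton] at h
    by_contra hc
    have := hw1 0
    have := hw1 1
    nlinarith
  have hr : 0 < 1 / K := by positivity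
  have hg : ∀ n : ℕ, (1 + 1 / K) ^ n ≤ ∑ k ∈ Finset.range (n + 1), w k := by
    intro n
    induction n with
    | zero => simpa using hw1 0
    | succ n ih =>
      rw [Finset.sum_range_succ]
      have h1 := hS (n + 1)
      have h2 : 1 / K * ∑ k ∈ Finset.range (n + 1), w k ≤ w (n + 1) := by
        rw [one_div, inv_mul_le_iff₀ hK0]; exact h1
      have h3 := mul_le_mul_of_nonneg_left ih (show 0 ≤ 1 + 1 / K by linarith)
      rw [pow_succ]
      nlinarith
  refine ⟨1 / K, hr, 1 + 1 / K, by linarith, fun n => ?_⟩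
  have h1 := hS (n + 1)
  have h2 := hg n
  rw [one_div, inv_mul_le_iff₀ hK0, ← one_div]
  linarith

/-- exponential lower growth is impossible when `log w` is sublinear -/
lemma no_growth (w : ℕ → ℝ) (a r : ℝ) (ha : 0 < a) (hr : 1 < r)
    (h : ∀ n : ℕ, a * r ^ n ≤ w (n + 1))
    (hlim : Filter.Tendsto (fun n : ℕ => Real.log (w (n + 1)) / (n : ℝ)) Filter.atTop (nhds 0)) : False := by
  have hl : 0 < Real.log r := Real.log_pos hr
  have h1 : Filter.Tendsto (fun n : ℕ => Real.log a / (n : ℝ)) Filter.atTop (nhds 0) :=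
    tendsto_const_div_atTop_nhds_zero_nat _
  have h2 := hlim.sub h1
  rw [sub_zero] at h2
  have h3 := (h2.eventually (gt_mem_nhds hl)).and (Filter.eventually_gt_atTop 0)
  obtain ⟨n, hn, hn0⟩ := h3.exists
  have hn0' : (0 : ℝ) < n := by exact_mod_cast hn0
  have h4 := Real.log_le_log (by positivity) (h n)
  rw [Real.log_mul ha.ne' (by positivity), Real.log_pow] at h4
  rw [← sub_div, div_lt_iff₀ hn0'] at hn
  linarith

lemma lim_beta (β : ℝ) (h1 : β < 1) :
    Filter.Tendsto (fun n : ℕ => ((n : ℝ) + 1) ^ β / (n : ℝ)) Filter.atTop (nhds 0) := by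
  have h := (tendsto_rpow_neg_atTop (show 0 < 1 - β by linarith)).comp
    (tendsto_natCast_atTop_atTop (R := ℝ) |>.comp (Filter.tendsto_add_atTop_nat 1))
  have h2 : Filter.Tendsto (fun n : ℕ => ((n : ℝ) + 1) / n) Filter.atTop (nhds 1) := by
    have h3 : Filter.Tendsto (fun n : ℕ => 1 + 1 / (n : ℝ)) Filter.atTop (nhds (1 + 0)) :=
      tendsto_const_nhds.add (tendsto_const_div_atTop_nhds_zero_nat 1)
    rw [add_zero] at h3
    refine h3.congr' ?_
    filter_upwards [Filter.eventually_gt_atTop 0] with n hn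
    have : (0 : ℝ) < n := by exact_mod_cast hn
    field_simp
  have h4 := h.mul h2
  rw [zero_mul] at h4
  refine h4.congr fun n => ?_
  have hp : (0 : ℝ) < (n : ℝ) + 1 := by positivity
  simp only [Function.comp_apply, Nat.cast_add, Nat.cast_one]
  rw [← mul_div_assoc]
  congr 1
  nth_rewrite 2 [← Real.rpow_one ((n : ℝ) + 1)]
  rw [← Real.rpow_add hp]
  congr 1; ring

lemma lim_log : Filter.Tendsto (fun n : ℕ => Real.log ((n : ℝ) + 2) / (n : ℝ)) Filter.atTop (nhds 0) := by
  have h := (lim_beta (1/2) (by norm_num)).const_mul 4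
  rw [mul_zero] at h
  refine squeeze_zero (fun n => ?_) (fun n => ?_) h
  · exact div_nonneg (Real.log_nonneg (by linarith [(Nat.cast_nonneg n : (0:ℝ) ≤ n)])) (Nat.cast_nonneg n)
  · rw [← mul_div_assoc]
    apply div_le_div_of_nonneg_right _ (Nat.cast_nonneg n)
    have hn : (0:ℝ) ≤ n := Nat.cast_nonneg n
    have h1 := Real.log_le_rpow_div (x := (n:ℝ) + 2) (by linarith) (show (0:ℝ) < 1/2 by norm_num)
    have h2 : ((n:ℝ) + 2) ^ (1/2 : ℝ) ≤ (4 * ((n:ℝ) + 1)) ^ (1/2 : ℝ) :=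
      Real.rpow_le_rpow (by linarith) (by linarith) (by norm_num)
    rw [Real.mul_rpow (by norm_num) (by linarith)] at h2
    have h3 : (4:ℝ) ^ (1/2 : ℝ) = 2 := by
      rw [show (4:ℝ) = 2 ^ (2:ℝ) by norm_num, ← Real.rpow_mul (by norm_num)]; norm_num
    rw [h3] at h2
    linarith

lemma part_i [Group G] (X : Finset G)
    (hXsym : ∀ x ∈ X, x⁻¹ ∈ X) (hXgen : Subgroup.closure (X : Set G) = ⊤)
    (ω : G → ℝ) (hω : IsWeight ω)
    (h : ((∃ α : ℝ, 0 ≤ α ∧ ∀ u : G, ω u = (1 + (wordLength (X : Set G) u : ℝ)) ^ α) ∨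
      (∃ c : ℝ, 1 ≤ c ∧ ∃ β : ℝ, 0 < β ∧ β < 1 ∧
        ∀ u : G, ω u = c ^ ((wordLength (X : Set G) u : ℝ) ^ β))))
    (hfg : IsFinGenLeftIdealOf ω (l1w0 ω)) : Finite G := by
  by_contra hinf
  rcases h with ⟨α, hα, h⟩ | ⟨c, hc, β, hβ0, hβ1, h⟩
  · obtain ⟨a, ha, r, hr, hg⟩ := growth X hXsym hXgen ω hω hfg hinf (fun n => (1 + (n : ℝ)) ^ α)
      (fun m n hmn => Real.rpow_le_rpow (by positivity) (by gcongr) hα)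
      (fun n => Real.one_le_rpow (by linarith [(Nat.cast_nonneg n : (0:ℝ) ≤ n)]) hα) h
    refine no_growth (fun n => (1 + (n : ℝ)) ^ α) a r ha hr hg ?_
    have := lim_log.const_mul α
    rw [mul_zero] at this
    refine this.congr fun n => ?_
    rw [Real.log_rpow (by positivity), mul_div_assoc]
    push_cast
    ring_nf
  · obtain ⟨a, ha, r, hr, hg⟩ := growth X hXsym hXgen ω hω hfg hinf (fun n => c ^ ((n : ℝ) ^ β))
      (fun m n hmn => Real.rpow_le_rpow_of_exponent_le hc
        (Real.rpow_le_rpow (by positivity) (by gcongr) hβ0.le))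
      (fun n => Real.one_le_rpow hc (by positivity)) h
    refine no_growth (fun n => c ^ ((n : ℝ) ^ β)) a r ha hr hg ?_
    have := (lim_beta β hβ1).const_mul (Real.log c)
    rw [mul_zero] at this
    refine this.congr fun n => ?_
    rw [Real.log_rpow (by linarith)]
    push_cast
    ring

open Classical in
lemma conv_mem [Group G] (ω : G → ℝ) (hω : IsWeight ω) (x : G → ℂ) (hx : x ∈ l1w0 ω)
    (a : G → ℂ) (ha : a ∈ l1w ω) : conv a x ∈ l1w0 ω := by
  have h0 : ∀ u, (ω u : ℂ) ≠ 0 := by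
    intro u
    have : 0 < ω u := by linarith [hω.1 u]
    exact_mod_cast this.ne'
  obtain ⟨T, hT1, hT2⟩ := exists_T ω hω x hx.1
  refine ⟨mem_of_toW ω hω.1 _ _ (hT2 a ha), ?_⟩
  obtain ⟨P, hP1, hP2⟩ := exists_P ω hω.1 (fun _ => (1:ℂ)) 1 (by simpa using hω.1)
  have h1 : P (T (toW ω hω.1 a ha)) = ∑' u, conv a x u := by
    rw [hP2]
    congr 1; ext u
    rw [hT2]; field_simp [h0 u]
  rw [← h1]
  have h2 := L1_hasSum (P.comp T) (toW ω hω.1 a ha)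
  have h3 : ∀ s, (P.comp T) (lp.single 1 s (1:ℂ)) = 0 := by
    intro s
    have := P_T ω hω x (fun _ => 1) P T hP2 hT1 s
    simp only [mul_one, hx.2, zero_div] at this
    exact this
  simp only [h3, smul_zero] at h2
  exact h2.unique hasSum_zero

lemma l1w0_add (ω : G → ℝ) (hp : ∀ u, 1 ≤ ω u) (f g : G → ℂ) (hf : f ∈ l1w0 ω) (hg : g ∈ l1w0 ω) :
    f + g ∈ l1w0 ω := by
  constructor
  · refine Summable.of_nonneg_of_le (fun u => ?_) (fun u => ?_) (Summable.add hf.1 hg.1)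
    · have := hp u; positivity
    · rw [← add_mul]
      exact mul_le_mul_of_nonneg_right (norm_add_le _ _) (by linarith [hp u])
  · have := (l1w_summable ω hp f hf.1).of_norm.tsum_add (l1w_summable ω hp g hg.1).of_norm
    rw [hf.2, hg.2, add_zero] at this
    exact this

lemma l1w0_smul (ω : G → ℝ) (c : ℂ) (f : G → ℂ) (hf : f ∈ l1w0 ω) :
    c • f ∈ l1w0 ω := by
  constructor
  · refine Summable.congr (Summable.mul_left ‖c‖ hf.1) fun u => ?_
    simp [mul_assoc]
  · have : ∑' u, (c • f) u = c * ∑' u, f u := by rw [← tsum_mul_left]; rfl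
    rw [this, hf.2, mul_zero]

open Classical in
lemma gen_mem [Group G] (ω : G → ℝ) (y : G) :
    (Pi.single y (1:ℂ) - Pi.single 1 1 : G → ℂ) ∈ l1w0 ω := by
  have h : ∀ z : G, HasSum (Pi.single z (1:ℂ) : G → ℂ) 1 := by
    intro z
    have := hasSum_single (f := (Pi.single z (1:ℂ) : G → ℂ)) z (fun b hb => by simp [hb])
    simpa using this
  constructor
  · apply summable_of_ne_finset_zero (s := {y, 1})
    intro b hb
    simp only [Finset.mem_insert, Finset.mem_singleton, not_or] at hb
    simp [hb.1, hb.2]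
  · have := ((h y).sub (h 1)).tsum_eq
    rw [sub_self] at this
    exact this

open Classical in
lemma part_ii [Group G] (X : Finset G)
    (hXsym : ∀ x ∈ X, x⁻¹ ∈ X) (hXgen : Subgroup.closure (X : Set G) = ⊤)
    (ω : G → ℝ) (hω : IsWeight ω)
    (h : ∃ c : ℝ, 1 < c ∧ ∀ u : G, ω u = c ^ (wordLength (X : Set G) u)) :
    IsFinGenLeftIdealOf ω (l1w0 ω) := by
  obtain ⟨c, hc, h⟩ := h
  have hpos : ∀ u, 0 < ω u := fun u => by linarith [hω.1 u]
  have h0 : ∀ u, (ω u : ℂ) ≠ 0 := fun u => by exact_mod_cast (hpos u).ne'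
  let x : Fin X.card → (G → ℂ) := fun i => Pi.single ((X.equivFin.symm i : X) : G) (1:ℂ) - Pi.single 1 1
  have hx0 : ∀ i, x i ∈ l1w0 ω := fun i => gen_mem ω _
  refine ⟨X.card, x, fun i => (hx0 i).1, ?_⟩
  apply Set.Subset.antisymm
  · intro f hf
    choose T hT1 hT2 using fun i => exists_T ω hω (x i) (hx0 i).1
    have hh : ∀ n : ℕ, ∀ u, wordLength (X : Set G) u = n → ∃ k : Fin X.card → L1s G,
        ∑ i, T i (k i) = (ω u : ℂ) • lp.single 1 u (1:ℂ) - lp.single 1 (1:G) (1:ℂ) ∧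
        ∀ i, ‖k i‖ ≤ ∑ j ∈ Finset.range n, c ^ j := by
      intro n
      induction n with
      | zero =>
        intro u hu
        obtain ⟨l, h1, h2, rfl⟩ := wl_spec X hXsym hXgen u
        rw [hu] at h1
        have : l = [] := List.length_eq_zero_iff.1 h1
        subst this
        exact ⟨0, by simp [hω.2.1], by simp⟩
      | succ n ih =>
        intro u hu
        obtain ⟨v, y, hy, rfl, hv⟩ := wl_pred X hXsym hXgen u n hu
        obtain ⟨k, hk1, hk2⟩ := ih v hv
        let i0 : Fin X.card := X.equivFin ⟨y, hy⟩
        have hxi0 : x i0 = Pi.single y (1:ℂ) - Pi.single 1 1 := by simp [x, i0]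
        refine ⟨fun i => k i + if i = i0 then (ω v : ℂ) • lp.single 1 v (1:ℂ) else 0, ?_, ?_⟩
        · simp only [map_add, Finset.sum_add_distrib, hk1]
          rw [Finset.sum_eq_single i0]
          · rw [if_pos rfl, map_smul]
            have : (ω v : ℂ) • T i0 (lp.single 1 v (1:ℂ)) =
                (ω (v * y) : ℂ) • lp.single 1 (v * y) (1:ℂ) - (ω v : ℂ) • lp.single 1 v (1:ℂ) := by
              ext u
              simp only [lp.coeFn_sub, Pi.sub_apply, lp.coeFn_smul, Pi.smul_apply, smul_eq_mul, hT1,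
                hxi0, lp.coeFn_single]
              rw [mul_div_cancel₀ _ (h0 v)]
              have e1 : (Pi.single y (1:ℂ) : G → ℂ) (v⁻¹ * u) = (Pi.single (v * y) (1:ℂ) : G → ℂ) u := by
                simp only [Pi.single_apply, inv_mul_eq_iff_eq_mul]
              have e2 : (Pi.single 1 (1:ℂ) : G → ℂ) (v⁻¹ * u) = (Pi.single v (1:ℂ) : G → ℂ) u := by
                simp only [Pi.single_apply, inv_mul_eq_iff_eq_mul, mul_one]
              rw [e1, e2, sub_mul]
              congr 1
              · by_cases hh : u = v * y
                · subst hh; simp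
                · simp [hh]
              · by_cases hh : u = v
                · subst hh; simp
                · simp [hh]
            rw [this]; abel
          · intro i _ hi; simp [hi]
          · simp
        · intro i
          rw [Finset.sum_range_succ]
          refine (norm_add_le _ _).trans (add_le_add (hk2 i) ?_)
          by_cases hi : i = i0
          · rw [if_pos hi, norm_smul, lp.norm_single (by simp), h v, hv]
            simp [abs_of_pos (show 0 < c by linarith)]
          · rw [if_neg hi, norm_zero]; positivity
    choose k hk1 hk2 using fun u => hh _ u rfl
    have hkb : ∀ i u, ‖((ω u : ℂ)⁻¹) • k u i‖ ≤ 1 / (c - 1) := by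
      intro i u
      rw [norm_smul, norm_inv, Complex.norm_real, Real.norm_eq_abs, abs_of_pos (hpos u),
        inv_mul_le_iff₀ (hpos u)]
      refine (hk2 u i).trans ?_
      rw [geom_sum_eq hc.ne', h u, mul_one_div]
      apply div_le_div_of_nonneg_right _ (by linarith)
      linarith
    choose L hL using fun i => L1_exists (fun u => ((ω u : ℂ)⁻¹) • k u i) _ (hkb i)
    obtain ⟨P, hP1, hP2⟩ := exists_P ω hω.1 (fun _ => (1:ℂ)) 1 (by simpa using hω.1)
    let S : L1s G →L[ℂ] L1s G := ∑ i, (T i).comp (L i)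
    let S' : L1s G →L[ℂ] L1s G := ContinuousLinearMap.id ℂ _ -
      (ContinuousLinearMap.toSpanSingleton ℂ (lp.single 1 (1:G) (1:ℂ) : L1s G)).comp P
    have hS : ∀ a, S a = ∑ i, T i (L i a) := by intro a; simp [S]
    have hS' : ∀ a, S' a = a - P a • (lp.single 1 (1:G) (1:ℂ) : L1s G) := by intro a; simp [S']
    have hSS : ∀ s, S (lp.single 1 s (1:ℂ)) = S' (lp.single 1 s (1:ℂ)) := by
      intro s
      rw [hS, hS', hP1]
      simp only [hL, map_smul]
      rw [← Finset.smul_sum, hk1, smul_sub, smul_smul, inv_mul_cancel₀ (h0 s), one_smul, one_div]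
    have hSf : S (toW ω hω.1 f hf.1) = toW ω hω.1 f hf.1 := by
      have h1 := L1_hasSum S (toW ω hω.1 f hf.1)
      have h2 := L1_hasSum S' (toW ω hω.1 f hf.1)
      simp only [hSS] at h1
      rw [h1.unique h2, hS', hP2]
      have : ∑' u, (toW ω hω.1 f hf.1) u * (1 / (ω u : ℂ)) = 0 := by
        refine Eq.trans ?_ hf.2
        congr 1; ext u
        rw [toW_apply]; field_simp [h0 u]
      rw [this, zero_smul, sub_zero]
    refine ⟨fun i u => L i (toW ω hω.1 f hf.1) u / (ω u : ℂ), 0,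
      fun i => ofW_mem ω hω.1 _, ?_⟩
    ext u
    have h1 : S (toW ω hω.1 f hf.1) u = f u * ω u := by rw [hSf, toW_apply]
    rw [hS, lp.coeFn_sum, Finset.sum_apply] at h1
    have h2 : ∀ i, T i (L i (toW ω hω.1 f hf.1)) u =
        conv (fun u => L i (toW ω hω.1 f hf.1) u / (ω u : ℂ)) (x i) u * ω u := by
      intro i
      rw [← hT2 i _ (ofW_mem ω hω.1 _), toW_ofW]
    simp only [h2] at h1
    rw [← Finset.sum_mul] at h1
    have h3 := mul_right_cancel₀ (h0 u) h1
    rw [← h3]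
    simp
  · rintro f ⟨a, d, ha, rfl⟩
    refine Finset.sum_induction _ (fun f => f ∈ l1w0 ω) (fun f g => l1w0_add ω hω.1 f g) ?_ ?_
    · constructor
      · simp [l1w, summable_zero]
      · simp
    · intro i _
      exact l1w0_add ω hω.1 _ _ (conv_mem ω hω _ (hx0 i) _ (ha i)) (l1w0_smul ω _ _ (hx0 i))

/-- Corollary 1.7: let `G` be a finitely-generated discrete group with finite symmetric
generating set `X`, and let `ω` be a weight on `G`.
(i) If `ω` is a radial polynomial weight `ω(u) = (1+|u|)^α` (`α ≥ 0`), or a radial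
exponential weight `ω(u) = c^(|u|^β)` of degree `β < 1` (`c ≥ 1`, `0 < β < 1`), then
`ℓ¹₀(G, ω)` is finitely generated only if `G` is finite.
(ii) If `ω` is a radial exponential weight of degree `1`, `ω(u) = c^|u|` with base
`c > 1`, then `ℓ¹₀(G, ω)` is finitely generated. -/
theorem stmt11 [Group G] (X : Finset G)
    (hXsym : ∀ x ∈ X, x⁻¹ ∈ X) (hXgen : Subgroup.closure (X : Set G) = ⊤)
    (ω : G → ℝ) (hω : IsWeight ω) :
    (((∃ α : ℝ, 0 ≤ α ∧ ∀ u : G, ω u = (1 + (wordLength (X : Set G) u : ℝ)) ^ α) ∨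
      (∃ c : ℝ, 1 ≤ c ∧ ∃ β : ℝ, 0 < β ∧ β < 1 ∧
        ∀ u : G, ω u = c ^ ((wordLength (X : Set G) u : ℝ) ^ β))) →
      IsFinGenLeftIdealOf ω (l1w0 ω) → Finite G)
    ∧
    ((∃ c : ℝ, 1 < c ∧ ∀ u : G, ω u = c ^ (wordLength (X : Set G) u)) →
      IsFinGenLeftIdealOf ω (l1w0 ω)) := by
  exact ⟨part_i X hXsym hXgen ω hω, part_ii X hXsym hXgen ω hω⟩
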